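/- arXiv:2310.12896 — 2 statements merged into one kernel-verified Lean document; each statement's English description precedes it below -/
import Mathlib

section
/- TI bisects angle LTM; that is, ∠LTI = ∠ITM. -/
open EuclideanGeometry Real RealInnerProductSpace Affine

/-- The Euclidean plane. -/
abbrev Plane := EuclideanSpace ℝ (Fin 2)


lemma core_xy (b1 r a1 a2 : ℝ) (hr : 0 < r) (ha2 : 0 < a2) 
   (hAB : ((a1-b1)*r + a2*b1)^2 = r^2*((a1-b1)^2+a2^2)) (h : (a1-b1)*r + a2*b1 < 0) :
   b1 < 0 ∧ a2 * (b1^2-r^2) = - 2*r*b1*(a1-b1) := by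
  have e : a2 * (b1^2-r^2) = - 2*r*b1*(a1-b1) := by
    apply mul_left_cancel₀ ha2.ne'
    linear_combination hAB
  refine ⟨?_, e⟩
  by_contra hb
  push Not at hb
  rcases hb.eq_or_lt with hb | hb
  · subst hb
    have := mul_pos ha2 (pow_pos hr 2)
    nlinarith
  · have := mul_pos hb (neg_pos.2 h)
    have := mul_pos ha2 (pow_pos hr 2)
    have := mul_pos ha2 (pow_pos hb 2)
    nlinarith

lemma distsq (P Q : Plane) : dist P Q ^ 2 = (P 0 - Q 0)^2 + (P 1 - Q 1)^2 := by
  rw [EuclideanSpace.dist_eq, Real.sq_sqrt (by positivity)]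
  simp [Real.dist_eq, sq_abs]

lemma line_coords {A B P : Plane} (h : P ∈ affineSpan ℝ ({A, B} : Set Plane)) :
    ∃ s : ℝ, ∀ i, P i = A i + s * (B i - A i) := by
  obtain ⟨s, rfl⟩ := mem_affineSpan_pair_iff_exists_lineMap_eq.1 h
  exact ⟨s, fun i => by simp [AffineMap.lineMap_apply]; ring⟩

lemma infDist_cross {A B P : Plane} {d : ℝ} (hAB : 0 < (B 0 - A 0)^2 + (B 1 - A 1)^2)
    (h : Metric.infDist P (affineSpan ℝ ({A, B} : Set Plane) : Set Plane) = d) :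
    ((B 0 - A 0)*(P 1 - A 1) - (B 1 - A 1) * (P 0 - A 0))^2 = d^2*((B 0 - A 0)^2 + (B 1 - A 1)^2) := by
  obtain ⟨n, hn⟩ : ∃ n, n = (B 0 - A 0)^2 + (B 1 - A 1)^2 := ⟨_, rfl⟩
  rw [← hn] at hAB ⊢
  obtain ⟨s, hs⟩ : ∃ s, s = ((B 0 - A 0)*(P 0 - A 0) + (B 1 - A 1) * (P 1 - A 1)) / n := ⟨_, rfl⟩
  have hsn : s * n = (B 0 - A 0)*(P 0 - A 0) + (B 1 - A 1) * (P 1 - A 1) := by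
    rw [hs]; field_simp
  set F : Plane := AffineMap.lineMap A B s with hF
  have hFm : F ∈ (affineSpan ℝ ({A, B} : Set Plane) : Set Plane) :=
    mem_affineSpan_pair_iff_exists_lineMap_eq.2 ⟨s, rfl⟩
  have hFi : ∀ i, F i = A i + s * (B i - A i) := fun i => by
    simp [hF, AffineMap.lineMap_apply]; ring
  have hd : d = dist P F := by
    rw [← h]
    apply le_antisymm (Metric.infDist_le_dist_of_mem hFm)
    refine (Metric.le_infDist ⟨F, hFm⟩).2 ?_
    intro Q hQ
    obtain ⟨q, hq⟩ := line_coords hQ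
    apply (pow_le_pow_iff_left₀ dist_nonneg dist_nonneg two_ne_zero).1
    rw [distsq, distsq, hFi, hFi, hq, hq]
    have : 0 ≤ (q - s)^2 * n := by positivity
    rw [hn] at this hsn
    linear_combination this - 2 * (q - s) * hsn
  rw [hd, distsq, hFi, hFi]
  rw [hn] at hsn ⊢
  linear_combination -(s * ((B 0 - A 0)^2 + (B 1 - A 1)^2)  - ((B 0 - A 0)*(P 0 - A 0) + (B 1 - A 1) * (P 1 - A 1))) * hsn

lemma hull_coords {A B C : Plane} (hABC : AffineIndependent ℝ ![A, B, C]) (P : Plane) :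
    ∃ α β γ : ℝ, α + β + γ = 1 ∧ (∀ i, P i = α * A i + β * B i + γ * C i) ∧
      (P ∈ convexHull ℝ ({A, B, C} : Set Plane) → 0 ≤ α ∧ 0 ≤ β ∧ 0 ≤ γ) ∧ 
      (P ∈ interior (convexHull ℝ ({A, B, C} : Set Plane)) → 0 < α ∧ 0 < β ∧ 0 < γ) := by
  have hr : Set.range ![A,B,C] = {A,B,C} := by
    ext z
    simp [eq_comm]
    tauto
  let b : AffineBasis (Fin 3) ℝ Plane := ⟨![A,B,C], hABC, by
    rw [hABC.affineSpan_eq_top_iff_card_eq_finrank_add_one]; simp⟩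
  have hb : Set.range b = {A,B,C} := hr
  refine ⟨b.coord 0 P, b.coord 1 P, b.coord 2 P, ?_, ?_, ?_, ?_⟩
  · have := b.sum_coord_apply_eq_one P
    rwa [Fin.sum_univ_three] at this
  · intro i
    have := b.linear_combination_coord_eq_self P
    rw [Fin.sum_univ_three] at this
    have := congrArg (fun v : Plane => v i) this
    exact this.symm
  · intro h
    rw [← hb, b.convexHull_eq_nonneg_coord] at h
    exact ⟨h 0, h 1, h 2⟩
  · intro h
    rw [← hb, b.interior_convexHull] at h
    exact ⟨h 0, h 1, h 2⟩

lemma det_ne {A B C : Plane} (hABC : AffineIndependent ℝ ![A, B, C]) :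
    (B 0 - A 0) * (C 1 - A 1) - (B 1 - A 1) * (C 0 - A 0) ≠ 0 := by
  intro h
  obtain ⟨α, β, γ, h1, h2, -⟩ := hull_coords hABC (A + !₂[1, 0])
  obtain ⟨α', β', γ', h1', h2', -⟩ := hull_coords hABC (A + !₂[0, 1])
  have e0 := h2 0
  have e1 := h2 1
  have f0 := h2' 0
  have f1 := h2' 1
  simp at e0 e1 f0 f1
  have ha : α = 1 - β - γ := by linarith
  have ha' : α' = 1 - β' - γ' := by linarith
  subst ha ha'
  have e0' : 1 = β * (B 0 - A 0) + γ * (C 0 - A 0) := by linarith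
  have e1' : 0 = β * (B 1 - A 1) + γ * (C 1 - A 1) := by linarith
  have f0' : 0 = β' * (B 0 - A 0) + γ' * (C 0 - A 0) := by linarith
  have f1' : 1 = β' * (B 1 - A 1) + γ' * (C 1 - A 1) := by linarith
  have : (1:ℝ) * 1 - 0 * 0 = 0 := by
    calc (1:ℝ) * 1 - 0 * 0 = (β * (B 0 - A 0) + γ * (C 0 - A 0)) * (β' * (B 1 - A 1) + γ' * (C 1 - A 1)) - (β * (B 1 - A 1) + γ * (C 1 - A 1)) * (β' * (B 0 - A 0) + γ' * (C 0 - A 0)) := by rw [← e0', ← e1', ← f0', ← f1']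
      _ = 0 := by linear_combination (β * γ' - β' * γ) * h
  norm_num at this
lemma core_alg (x y r t s : ℝ) (hx : 0 < x) (hy : 0 < y) (hr : 0 < r) (hs : 0 < s)
    (hw : 0 < x * y - r ^ 2) (ht : 0 < t) (ht1 : t ≤ 1)
    (htan : ((1-t) * (r ^ 2 * (x - y) / (x*y-r^2)) - (y-x)/2)^2 +
      ((1-t) * (2*r*x*y/(x*y-r^2)) + t * r - (x+y)/4*(s-1/s))^2 = ((x+y)/4*(s+1/s) + t*r)^2) :
    s * (x*y-r^2) = (1-t) * r * (x+y) := by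
  have key : (s * (x*y-r^2) - (1-t) * r * (x+y)) * ((x+y) * r * (x*y - t*r^2) * s + x*y*(x*y-r^2)) = 0 := by
    have hw' := hw.ne'
    have : ((1-t) * (r ^ 2 * (x - y) / (x*y-r^2)) - (y-x)/2)^2 +
      ((1-t) * (2*r*x*y/(x*y-r^2)) + t * r - (x+y)/4*(s-1/s))^2 - ((x+y)/4*(s+1/s) + t*r)^2
      = - (s * (x*y-r^2) - (1-t) * r * (x+y)) * ((x+y) * r * (x*y - t*r^2) * s + x*y*(x*y-r^2)) / (s * (x*y-r^2)^2) := by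
      field_simp
      ring
    rw [htan, sub_self] at this
    have h2 : s * (x*y-r^2)^2 ≠ 0 := by positivity
    field_simp at this
    linarith
  rcases mul_eq_zero.1 key with h | h
  · linarith
  · have : 0 < x*y - t*r^2 := by nlinarith [sq_nonneg r]
    have : 0 < (x+y) * r * (x*y - t*r^2) * s + x*y*(x*y-r^2) := by positivity
    linarith

lemma core_alg2 (x y r s : ℝ) (hx : 0 < x) (hy : 0 < y) (hr : 0 < r) (hs : 0 < s)
    (w t R k a1 a2 T1 T2 : ℝ) (hw : 0 < w) (hwd : w = x * y - r ^ 2) (ht : 0 < t)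
    (h : t = 1 - s * w / (r * (x+y)))
    (hR : R = (x+y)/4*(s+1/s)) (hk : k = (x+y)/4*(s-1/s))
    (ha1 : a1 = r^2*(x-y)/w) (ha2 : a2 = 2*r*x*y/w)
    (hT1 : T1 = (R * ((1-t)*a1) + t*r*((y-x)/2))/(R+t*r))
    (hT2 : T2 = (R * ((1-t)*a2+t*r) + t*r*k)/(R+t*r)) :
    t^2*(T1^2+T2^2) = (1-t)^2*((T1-a1)^2+(T2-a2)^2) := by
  have hRp : 0 < R := by rw [hR]; positivity
  have hN : R + t*r ≠ 0 := by positivity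
  have e1 : (R+t*r) * T1 = R * ((1-t)*a1) + t*r*((y-x)/2) := by rw [hT1]; field_simp
  have e2 : (R+t*r) * T2 = R * ((1-t)*a2+t*r) + t*r*k := by rw [hT2]; field_simp
  have key : t^2*((R * ((1-t)*a1) + t*r*((y-x)/2))^2+(R * ((1-t)*a2+t*r) + t*r*k)^2) = (1-t)^2*((R * ((1-t)*a1) + t*r*((y-x)/2)-(R+t*r)*a1)^2+(R * ((1-t)*a2+t*r) + t*r*k-(R+t*r)*a2)^2) := by
    subst hR hk h ha1 ha2
    subst hwd
    have := hw.ne'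
    field_simp
    ring
  rw [← e1, ← e2] at key
  have : (R+t*r)^2 ≠ 0 := by positivity
  apply mul_left_cancel₀ this
  linear_combination key

lemma core (b1 c1 r a1 a2 t o1 o2 R d1 d2 T1 T2 : ℝ) (hr : 0 < r) (ha2 : 0 < a2)
    (hAB : ((a1-b1)*r + a2*b1)^2 = r^2*((a1-b1)^2+a2^2)) (hABs : (a1-b1)*r + a2*b1 < 0)
    (hAC : ((a1-c1)*r + a2*c1)^2 = r^2*((a1-c1)^2+a2^2)) (hACs : 0 < (a1-c1)*r + a2*c1)
    (ht : 0 < t) (hd1 : d1 = (1-t)*a1) (hd2 : d2 = (1-t)*a2 + t*r) (hdt : 0 ≤ d2 - t*r)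
    (hR : 0 < R) (hOB : (o1-b1)^2+o2^2 = R^2) (hOC : (o1-c1)^2+o2^2=R^2)
    (hext : (o1-d1)^2+(o2-d2)^2 = (R+t*r)^2)
    (hT1 : (R+t*r)*T1 = R*d1+t*r*o1) (hT2 : (R+t*r)*T2 = R*d2+t*r*o2) :
    t < 1 ∧ t^2*(T1^2+T2^2) = (1-t)^2*((T1-a1)^2+(T2-a2)^2) := by
  obtain ⟨hb, eb⟩ := core_xy b1 r a1 a2 hr ha2 hAB hABs
  obtain ⟨hc, ec⟩ := core_xy (-c1) r (-a1) a2 hr ha2 (by linear_combination hAC) (by linarith)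
  have ht1 : t ≤ 1 := by
    by_contra h
    push Not at h
    nlinarith
  obtain ⟨x, rfl⟩ : ∃ x, b1 = -x := ⟨-b1, by ring⟩
  rename' c1 => y
  have hx : 0 < x := by linarith
  have hy : 0 < y := by linarith
  have hxy : 0 < x + y := by linarith
  have ho1 : o1 = (y-x)/2 := by
    apply mul_left_cancel₀ hxy.ne'
    linear_combination (hOB - hOC)/2
  have ew : a2 * (x*y-r^2) = 2*r*x*y := by
    apply mul_left_cancel₀ hxy.ne'
    linear_combination y * eb + x * ec
  have hw : 0 < x*y-r^2 := by
    by_contra h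
    push Not at h
    have : 0 < 2*r*x*y := by positivity
    nlinarith
  have ha2' : a2 = 2*r*x*y/(x*y-r^2) := by
    rw [eq_div_iff hw.ne']; exact ew
  have ha1' : a1 = r^2*(x-y)/(x*y-r^2) := by
    rw [eq_div_iff hw.ne']
    apply mul_left_cancel₀ (show 2*r*x ≠ 0 by positivity)
    linear_combination -(x*y-r^2) * eb + (x^2-r^2) * ew
  obtain ⟨s, hs⟩ : ∃ s, s = 2*(R+o2)/(x+y) := ⟨_, rfl⟩
  have hRo : R^2 = o2^2 + ((x+y)/2)^2 := by rw [← hOB, ho1]; ring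
  have hlt : 0 < R + o2 := by
    have : |o2| < R := abs_lt_of_sq_lt_sq (by rw [hRo]; linarith [pow_pos (half_pos hxy) 2]) hR.le
    linarith [neg_abs_le o2]
  have hsp : 0 < s := by rw [hs]; positivity
  have hinv : 1/s = 2*(R-o2)/(x+y) := by
    rw [hs]; field_simp; linear_combination -4 * hRo
  have hR' : R = (x+y)/4*(s+1/s) := by rw [hinv, hs]; field_simp; ring
  have ho2 : o2 = (x+y)/4*(s-1/s) := by rw [hinv, hs]; field_simp; ring
  have key := core_alg x y r t s hx hy hr hsp hw ht ht1 (by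
    rw [← hR', ← ho2, ← ha1', ← ha2', ← hext, hd1, hd2, ho1]; ring)
  have hts : t = 1 - s * (x*y-r^2) / (r*(x+y)) := by rw [key]; field_simp; ring
  have hlt1 : t < 1 := by
    rw [hts]
    have : 0 < s * (x*y-r^2) / (r*(x+y)) := by positivity
    linarith
  have hN : R + t*r ≠ 0 := by positivity
  refine ⟨hlt1, core_alg2 x y r s hx hy hr hsp (x*y-r^2) t R o2 a1 a2 T1 T2 hw rfl ht hts hR' ho2 ha1' ha2' ?_ ?_⟩
  · rw [eq_div_iff hN, ← ho1, ← hd1]; linarith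
  · rw [eq_div_iff hN, ← hd2]; linarith

lemma frame (p q f e A0 A1 B0 B1 C0 C1 T0 T1 O0 O1 r t R α β γ α' β' γ' b1 c1 : ℝ)
    (hr : 0 < r) (hR : 0 < R) (ht : 0 < t)
    (hpq : p^2+q^2 = 1) (hfe : f^2+e^2 = 1) (hperp : p*f+q*e = 0)
    (hbc : b1 < c1) (hB0 : B0 = b1 * p) (hB1 : B1 = b1 * q) (hC0 : C0 = c1 * p) (hC1 : C1 = c1 * q)
    (hα : 0 < α) (hβ : 0 < β) (hγ : 0 < γ) (hsum : α + β + γ = 1)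
    (hI0 : r * f = α * A0 + β * B0 + γ * C0) (hI1 : r * e = α * A1 + β * B1 + γ * C1)
    (hα' : 0 ≤ α') 
    (hD0 : (1-t) * A0 = α' * A0 + β' * B0 + γ' * C0) (hD1 : (1-t) * A1 = α' * A1 + β' * B1 + γ' * C1)
    (hAB : ((B0 - A0)*(r*e - A1) - (B1 - A1) * (r*f-A0))^2 = r^2 * ((B0-A0)^2+(B1-A1)^2))
    (hAC : ((C0 - A0)*(r*e - A1) - (C1 - A1) * (r*f-A0))^2 = r^2 * ((C0-A0)^2+(C1-A1)^2))
    (hOB : (B0-O0)^2+(B1-O1)^2=R^2) (hOC : (C0-O0)^2+(C1-O1)^2=R^2)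
    (hext : (O0-((1-t)*A0+t*(r*f)))^2+(O1-((1-t)*A1+t*(r*e)))^2 = (R+t*r)^2)
    (hT0 : (R+t*r)*T0 = R*((1-t)*A0+t*(r*f)) + t*r*O0)
    (hT1 : (R+t*r)*T1 = R*((1-t)*A1+t*(r*e)) + t*r*O1) :
    t < 1 ∧ t^2*(T0^2+T1^2) = (1-t)^2*((T0-A0)^2+(T1-A1)^2) := by
  obtain ⟨δ, hδ⟩ : ∃ δ, δ = p*e-q*f := ⟨_, rfl⟩
  have hp : p = e * δ := by rw [hδ]; linear_combination -p * hfe + f * hperp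
  have hq : q = - f * δ := by rw [hδ]; linear_combination -q * hfe + e * hperp
  have hδ2 : δ^2 = 1 := by rw [hδ]; linear_combination (f^2+e^2) * hpq + hfe - (p*f+q*e)*hperp
  have h1 : p^2+f^2 = 1 := by rw [hp]; linear_combination e^2*hδ2+hfe
  have h2 : q^2+e^2 = 1 := by rw [hq]; linear_combination f^2*hδ2+hfe
  have h3 : p*q+f*e = 0 := by rw [hp, hq]; linear_combination -e*f*hδ2
  have ex : ∀ P0 P1 : ℝ, ∃ u v, P0 = u * p + v * f ∧ P1 = u * q + v * e := fun P0 P1 =>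
    ⟨P0*p+P1*q, P0*f+P1*e, by linear_combination -P0*h1-P1*h3, by linear_combination -P1*h2-P0*h3⟩
  have nrm : ∀ u v, (u*p+v*f)^2+(u*q+v*e)^2 = u^2+v^2 := fun u v => by
    linear_combination u^2*hpq+v^2*hfe+2*u*v*hperp
  have crs : ∀ u v u' v', ((u*p+v*f)*(u'*q+v'*e) - (u*q+v*e)*(u'*p+v'*f))^2 = (u*v'-v*u')^2 := fun u v u' v' => by
    have : (u*p+v*f)*(u'*q+v'*e) - (u*q+v*e)*(u'*p+v'*f) = δ*(u*v'-v*u') := by rw [hδ]; ring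
    rw [this, mul_pow, hδ2, one_mul]
  have inj : ∀ u v u' v', u*p+v*f = u'*p+v'*f → u*q+v*e=u'*q+v'*e → u = u' ∧ v = v' := fun u v u' v' k1 k2 =>
    ⟨by linear_combination p*k1+q*k2 - (u-u')*hpq - (v-v')*hperp,
     by linear_combination f*k1+e*k2 - (v-v')*hfe - (u-u')*hperp⟩
  obtain ⟨a1, a2, hA0, hA1⟩ := ex A0 A1
  obtain ⟨o1, o2, hO0, hO1⟩ := ex O0 O1
  obtain ⟨s1, s2, hS0, hS1⟩ := ex T0 T1
  subst hA0 hA1 hO0 hO1 hS0 hS1 hB0 hB1 hC0 hC1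
  obtain ⟨i1, i2⟩ := inj 0 r (α*a1+β*b1+γ*c1) (α*a2) (by linarith) (by linarith)
  obtain ⟨-, j2⟩ := inj ((1-t)*a1) ((1-t)*a2) (α'*a1+β'*b1+γ'*c1) (α'*a2) (by linarith) (by linarith)
  obtain ⟨k1, k2⟩ := inj ((R+t*r)*s1) ((R+t*r)*s2) (R*((1-t)*a1)+t*r*o1) (R*((1-t)*a2+t*r)+t*r*o2) (by linarith) (by linarith)
  have ha2 : 0 < a2 := by
    exact (mul_pos_iff_of_pos_left hα).1 (by rw [← i2]; exact hr)
  have hs : β = 1 - α - γ := by linarith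
  have hs' : γ = 1 - α - β := by linarith
  have hpos : 0 < a2 * (c1 - b1) := mul_pos ha2 (by linarith)
  have hbb : (a1-b1)*r + a2*b1 = -(γ * (a2 * (c1-b1))) := by
    subst hs; linear_combination (a1 - b1) * i2 - a2 * i1
  have hcc : (a1-c1)*r + a2*c1 = β * (a2 * (c1-b1)) := by
    subst hs'; linear_combination (a1 - c1) * i2 - a2 * i1
  have := core b1 c1 r a1 a2 t o1 o2 R ((1-t)*a1) ((1-t)*a2+t*r) s1 s2 hr ha2
    (by linear_combination hAB - crs (b1-a1) (-a2) (-a1) (r-a2) + r^2 * nrm (b1-a1) (-a2))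
    (by rw [hbb]; linarith [mul_pos hγ hpos])
    (by linear_combination hAC - crs (c1-a1) (-a2) (-a1) (r-a2) + r^2 * nrm (c1-a1) (-a2))
    (by rw [hcc]; exact mul_pos hβ hpos) ht rfl rfl
    (by rw [add_sub_cancel_right, j2]; positivity) hR
    (by linear_combination hOB - nrm (b1-o1) (-o2))
    (by linear_combination hOC - nrm (c1-o1) (-o2))
    (by linear_combination hext - nrm (o1 - (1-t)*a1) (o2 - ((1-t)*a2+t*r)))
    k1 k2
  refine ⟨this.1, ?_⟩
  linear_combination this.2 + t^2 * nrm s1 s2 - (1-t)^2 * nrm (s1-a1) (s2-a2)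

/-- In the Ajima-circle configuration, let `L` be the touch point of the incircle
with `BC` and `M` the intersection of line `AT` with line `BC`.
Then `TI` bisects `∠ L T M`: `∠ L T I = ∠ I T M`. -/
theorem TI_bisects_LTM
    (A B C I Oω D T : Plane) (r Rω ρ : ℝ)
    (hABC : AffineIndependent ℝ ![A, B, C])
    (hr : 0 < r)
    (hIin : I ∈ interior (convexHull ℝ ({A, B, C} : Set Plane)))
    (hIab : Metric.infDist I (affineSpan ℝ ({A, B} : Set Plane) : Set Plane) = r)
    (hIbc : Metric.infDist I (affineSpan ℝ ({B, C} : Set Plane) : Set Plane) = r)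
    (hIca : Metric.infDist I (affineSpan ℝ ({C, A} : Set Plane) : Set Plane) = r)
    (hRω : 0 < Rω) (hρ : 0 < ρ)
    (hBω : dist B Oω = Rω) (hCω : dist C Oω = Rω)
    (hγin : Metric.sphere D ρ ⊆ convexHull ℝ ({A, B, C} : Set Plane))
    (hγAB : Metric.infDist D (affineSpan ℝ ({A, B} : Set Plane) : Set Plane) = ρ)
    (hγAC : Metric.infDist D (affineSpan ℝ ({A, C} : Set Plane) : Set Plane) = ρ)
    (hext : dist Oω D = Rω + ρ)
    (hTω : dist T Oω = Rω) (hTγ : dist T D = ρ)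
    (hTseg : Wbtw ℝ Oω T D)
    (hTin : T ∈ interior (convexHull ℝ ({A, B, C} : Set Plane)))
    (L M : Plane)
    (hL : L ∈ affineSpan ℝ ({B, C} : Set Plane)) (hLI : dist I L = r)
    (hM₁ : M ∈ affineSpan ℝ ({A, T} : Set Plane))
    (hM₂ : M ∈ affineSpan ℝ ({B, C} : Set Plane)) :
    ∠ L T I = ∠ I T M := by
  have hS := det_ne hABC
  obtain ⟨S, hSd⟩ : ∃ S, S = (B 0 - A 0) * (C 1 - A 1) - (B 1 - A 1) * (C 0 - A 0) := ⟨_, rfl⟩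
  rw [← hSd] at hS
  have posn : ∀ u v : ℝ, (u ≠ 0 ∨ v ≠ 0) → 0 < u^2+v^2 := by
    intro u v h
    rcases h with h | h <;> positivity
  have nAB : 0 < (B 0 - A 0)^2 + (B 1 - A 1)^2 := by
    apply posn; by_contra! h; apply hS; rw [hSd, h.1, h.2]; ring
  have nAC : 0 < (C 0 - A 0)^2 + (C 1 - A 1)^2 := by
    apply posn; by_contra! h; apply hS; rw [hSd, h.1, h.2]; ring
  have nBC : 0 < (C 0 - B 0)^2 + (C 1 - B 1)^2 := by
    apply posn; by_contra! h; apply hS; rw [hSd]; linear_combination (B 0 - A 0) * h.2 - (B 1 - A 1) * h.1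
  rw [Set.pair_comm C A] at hIca
  have cIab := infDist_cross nAB hIab
  have cIac := infDist_cross nAC hIca
  have cIbc := infDist_cross nBC hIbc
  have cDab := infDist_cross nAB hγAB
  have cDac := infDist_cross nAC hγAC
  obtain ⟨l, hl⟩ := line_coords hL
  have hLI2 : (I 0 - L 0)^2 + (I 1 - L 1)^2 = r^2 := by rw [← distsq, hLI]
  have hperp : (C 0 - B 0) * (I 0 - L 0) + (C 1 - B 1) * (I 1 - L 1) = 0 := by
    apply pow_eq_zero_iff (two_ne_zero) |>.1
    rw [← hLI2] at cIbc
    have h0 := hl 0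
    have h1 := hl 1
    rw [h0, h1] at cIbc ⊢
    linear_combination -cIbc
  obtain ⟨α, β, γ, isum, iI, -, ipos⟩ := hull_coords hABC I
  obtain ⟨hα, hβ, hγ⟩ := ipos hIin
  obtain ⟨t, ht⟩ : ∃ t, t = ρ / r := ⟨_, rfl⟩
  have htr : ρ = t * r := by rw [ht]; field_simp
  have htp : 0 < t := by rw [ht]; positivity
  have hsph : ∀ σ : ℝ, σ^2 = 1 → D + (σ * t) • (I - L) ∈ convexHull ℝ ({A, B, C} : Set Plane) := by
    intro σ hσ
    apply hγin
    rw [Metric.mem_sphere]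
    apply (pow_left_inj₀ dist_nonneg hρ.le two_ne_zero).1
    rw [distsq, htr]
    simp only [PiLp.add_apply, PiLp.smul_apply, PiLp.sub_apply, smul_eq_mul]
    linear_combination (σ*t)^2 * hLI2 + t^2*r^2*hσ
  have hQ1 := hsph 1 (by norm_num)
  have hQ2 := hsph (-1) (by norm_num)
  have hDin : D ∈ convexHull ℝ ({A, B, C} : Set Plane) := by
    have := (convex_convexHull ℝ ({A, B, C} : Set Plane)) hQ1 hQ2 (a := 1/2) (b := 1/2) (by norm_num) (by norm_num) (by norm_num)
    convert this using 1
    module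
  obtain ⟨α', β', γ', dsum, dD, dpos, -⟩ := hull_coords hABC D
  obtain ⟨hα', hβ', hγ'⟩ := dpos hDin
  have hα1 : α = 1 - β - γ := by linarith
  have hα1' : α' = 1 - β' - γ' := by linarith
  have eγ : γ' = t * γ := by
    apply (pow_left_inj₀ hγ' (by positivity) two_ne_zero).1
    apply mul_left_cancel₀ (pow_ne_zero 2 hS)
    have k1 : (B 0 - A 0) * (I 1 - A 1) - (B 1 - A 1) * (I 0 - A 0) = γ * S := by
      rw [iI, iI, hα1, hSd]; ring
    have k2 : (B 0 - A 0) * (D 1 - A 1) - (B 1 - A 1) * (D 0 - A 0) = γ' * S := by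
      rw [dD, dD, hα1', hSd]; ring
    rw [k1] at cIab
    rw [k2, htr] at cDab
    linear_combination cDab - t^2 * cIab
  have eβ : β' = t * β := by
    apply (pow_left_inj₀ hβ' (by positivity) two_ne_zero).1
    apply mul_left_cancel₀ (pow_ne_zero 2 hS)
    have k1 : (C 0 - A 0) * (I 1 - A 1) - (C 1 - A 1) * (I 0 - A 0) = - β * S := by
      rw [iI, iI, hα1, hSd]; ring
    have k2 : (C 0 - A 0) * (D 1 - A 1) - (C 1 - A 1) * (D 0 - A 0) = - β' * S := by
      rw [dD, dD, hα1', hSd]; ring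
    rw [k1] at cIac
    rw [k2, htr] at cDac
    linear_combination cDac - t^2 * cIac
  have hDI : ∀ i, D i = (1-t) * A i + t * I i := by
    intro i
    rw [dD, iI, hα1', hα1, eγ, eβ]; ring
  have hTc : ∀ i, (Rω + t * r) * T i = Rω * D i + t * r * Oω i := by
    obtain ⟨s, ⟨hs0, -⟩, hs⟩ := hTseg
    have h1 := dist_lineMap_left Oω D s
    rw [hs, hTω, hext, Real.norm_of_nonneg hs0, htr] at h1
    intro i
    have h2 : T i = Oω i + s * (D i - Oω i) := by
      rw [← hs]; simp [AffineMap.lineMap_apply]; ring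
    rw [h2]
    linear_combination -(D i - Oω i) * h1
  obtain ⟨α₂, β₂, γ₂, qsum, qQ, qpos, -⟩ := hull_coords hABC (D + ((-1) * t) • (I - L))
  obtain ⟨hα₂, -, -⟩ := qpos hQ2
  have qc : ∀ i, (1-t) * (A i - L i) = α₂ * (A i - L i) + β₂ * (B i - L i) + γ₂ * (C i - L i) := by
    intro i
    have := qQ i
    simp only [PiLp.add_apply, PiLp.smul_apply, PiLp.sub_apply, smul_eq_mul, hDI] at this
    linear_combination this + L i * qsum
  obtain ⟨n, hn⟩ : ∃ n, n = √((C 0 - B 0)^2 + (C 1 - B 1)^2) := ⟨_, rfl⟩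
  have hnp : 0 < n := by rw [hn]; exact Real.sqrt_pos.2 nBC
  have hn2 : n^2 = (C 0 - B 0)^2 + (C 1 - B 1)^2 := by rw [hn]; exact Real.sq_sqrt nBC.le
  have hrf : ∀ i, r * ((I i - L i) / r) = I i - L i := fun i => by field_simp
  have dOB := distsq B Oω
  have dOC := distsq C Oω
  have dOD := distsq Oω D
  rw [hBω] at dOB
  rw [hCω] at dOC
  rw [hext, hDI, hDI, htr] at dOD
  obtain ⟨ht1, key⟩ := frame ((C 0 - B 0)/n) ((C 1 - B 1)/n) ((I 0 - L 0)/r) ((I 1 - L 1)/r)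
    (A 0 - L 0) (A 1 - L 1) (B 0 - L 0) (B 1 - L 1) (C 0 - L 0) (C 1 - L 1) (T 0 - L 0) (T 1 - L 1)
    (Oω 0 - L 0) (Oω 1 - L 1) r t Rω α β γ α₂ β₂ γ₂ (-l * n) ((1-l)*n) hr hRω htp
    (by rw [div_pow, div_pow, ← add_div, ← hn2]; field_simp)
    (by rw [div_pow, div_pow, ← add_div, hLI2]; field_simp)
    (by field_simp; linear_combination hperp)
    (by linarith)
    (by rw [hl]; field_simp; ring)
    (by rw [hl]; field_simp; ring)
    (by rw [hl]; field_simp; ring)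
    (by rw [hl]; field_simp; ring)
    hα hβ hγ isum
    (by rw [hrf]; linear_combination iI 0 + L 0 * isum)
    (by rw [hrf]; linear_combination iI 1 + L 1 * isum)
    hα₂ (qc 0) (qc 1)
    (by rw [hrf, hrf]; linear_combination cIab)
    (by rw [hrf, hrf]; linear_combination cIac)
    (by linear_combination -dOB)
    (by linear_combination -dOC)
    (by rw [hrf, hrf]; linear_combination -dOD)
    (by rw [hrf]; have := hTc 0; rw [hDI] at this; linear_combination this)
    (by rw [hrf]; have := hTc 1; rw [hDI] at this; linear_combination this)
  obtain ⟨T', hT'⟩ : ∃ T' : Plane, T' = A + (1/t) • (T - A) := ⟨_, rfl⟩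
  have hT'i : ∀ i, T' i = A i + (1/t) * (T i - A i) := fun i => by simp [hT']
  have dTD := distsq T D
  rw [hTγ, htr] at dTD
  have hIT' : dist I T' = r := by
    apply (pow_left_inj₀ dist_nonneg hr.le two_ne_zero).1
    rw [distsq, hT'i, hT'i]
    rw [hDI, hDI] at dTD
    field_simp
    linear_combination -dTD
  have hTT' : dist T L = dist T T' := by
    apply (pow_left_inj₀ dist_nonneg dist_nonneg two_ne_zero).1
    rw [distsq, distsq, hT'i, hT'i]
    field_simp
    linear_combination key
  have hang : ∠ L T I = ∠ T' T I := by
    unfold EuclideanGeometry.angle InnerProductGeometry.angle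
    rw [real_inner_eq_norm_mul_self_add_norm_mul_self_sub_norm_sub_mul_self_div_two,
      real_inner_eq_norm_mul_self_add_norm_mul_self_sub_norm_sub_mul_self_div_two]
    simp only [vsub_eq_sub, sub_sub_sub_cancel_right, ← dist_eq_norm]
    rw [dist_comm L T, dist_comm T' T, hTT', dist_comm L I, dist_comm T' I, hIT', hLI]
  rw [hang, EuclideanGeometry.angle_comm T' T I]
  obtain ⟨m, hm⟩ := line_coords hM₁
  obtain ⟨l', hl'⟩ := line_coords hM₂
  obtain ⟨a, b, c, tsum, tT, -, tpos⟩ := hull_coords hABC T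
  obtain ⟨ha, hb, hc⟩ := tpos hTin
  have hc1 : c = 1 - a - b := by linarith
  have hma : m * (1 - a) = 1 := by
    apply mul_left_cancel₀ hS
    have h0 := hl' 0
    have h1 := hl' 1
    rw [hm, tT, hc1] at h0 h1
    rw [hSd]
    linear_combination -(C 0 - B 0) * h1 + (C 1 - B 1) * h0
  have hm1 : 0 < m - 1 := by
    have h1a : 0 < 1 - a := by linarith
    apply (mul_pos_iff_of_pos_right h1a).1
    linarith
  have hMT : M - T = ((m-1) * (t/(1-t))) • (T' - T) := by
    have h1t : 1 - t ≠ 0 := by linarith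
    ext i
    simp only [PiLp.smul_apply, PiLp.sub_apply, smul_eq_mul, hT'i, hm]
    field_simp
    ring
  unfold EuclideanGeometry.angle
  simp only [vsub_eq_sub]
  rw [hMT, InnerProductGeometry.angle_smul_right_of_pos]
  have : 0 < 1 - t := by linarith
  positivity
end

section
/- Lines TI and TL' are perpendicular; that is, ∠ITL' = π/2. -/
open EuclideanGeometry Real RealInnerProductSpace Affine

/-- final algebra -/
theorem aj_alg (r m P δ S t j R w : ℝ) (hr : 0 < r) (hδ : 0 < δ) (hS : S < 0) (hP : P < 0)
    (hSP : S = P + r^2) (hδP : δ = m^2 - P) (ht : 0 < t) (htw : t = w + R) (hj : 0 ≤ j)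
    (hR : R^2 = δ + w^2) (x h : ℝ) (hx : S * x = 2*r^2*m) (hh : S * h = 2*r*P)
    (tan : (j*x - m)^2 + (j*h + (1-j)*r - w)^2 = (R + (1-j)*r)^2) :
    (-((1-j)*r*m + R*(j*x))) * (m - j*x) +
      ((R+(1-j)*r)*r - (1-j)*r*w - R*(j*h+(1-j)*r)) * (t - j*h) = 0 := by
  have hS0 : S ≠ 0 := hS.ne
  obtain rfl : x = 2*r^2*m/S := by field_simp; linarith
  obtain rfl : h = 2*r*P/S := by field_simp; linarith
  have hw : w = (t - δ/t)/2 := by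
    field_simp; rw [htw]; nlinarith
  have hR' : R = (t + δ/t)/2 := by
    field_simp; rw [htw]; nlinarith
  have key : (2*r*(r^2*j - S)*t + P*S) * (S*t + 2*r*δ*j) = 0 := by
    have : ((j*(2*r^2*m/S) - m)^2 + (j*(2*r*P/S) + (1-j)*r - w)^2 - (R + (1-j)*r)^2)*(t*S^2) = 0 := by
      rw [tan]; ring
    rw [← this, hR', hw]
    field_simp
    have hm : m^2 = δ + P := by linarith
    have hr2 : r^2 = S - P := by linarith
    subst hSP
    subst hδP
    ring
  have hF1 : S*t + 2*r*δ*j = 0 := by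
    rcases mul_eq_zero.1 key with h1 | h1
    · exfalso
      have : 0 < P*S := mul_pos_of_neg_of_neg hP hS
      have : 0 < 2*r*(r^2*j - S)*t := by
        have : 0 < r^2*j - S := by nlinarith [mul_nonneg (sq_nonneg r) hj]
        positivity
      linarith
    · exact h1
  have hj' : j = -S*t/(2*r*δ) := by field_simp; linarith
  have e1 : j*(2*r^2*m/S) = -r*t*m/δ := by rw [hj']; field_simp
  have e2 : j*(2*r*P/S) = -t*P/δ := by rw [hj']; field_simp
  rw [e1, e2, hR', hw, hj', hSP]
  have hPm : P = m^2 - δ := by linarith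
  rw [hPm]
  field_simp
  ring

set_option maxHeartbeats 4000000 in
theorem aj_core (a1 a2 b1 b2 c1 c2 d1 d2 o1 o2 t1 t2 l1 l2 x1 x2 r R ρ : ℝ)
    (hr : 0 < r) (hR : 0 < R) (hρ : 0 < ρ)
    (hΔ : (b1-a1)*(c2-a2)-(b2-a2)*(c1-a1) ≠ 0)
    (α β γ : ℝ) (hα : 0 ≤ α) (hβ : 0 ≤ β) (hγ : 0 ≤ γ) (hs : α+β+γ=1)
    (hI1 : 0 = α*a1+β*b1+γ*c1) (hI2 : r = α*a2+β*b2+γ*c2)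
    (hIab : ((0-a1)*(b2-a2)-(r-a2)*(b1-a1))^2 = r^2*((b1-a1)^2+(b2-a2)^2))
    (hIbc : ((0-b1)*(c2-b2)-(r-b2)*(c1-b1))^2 = r^2*((c1-b1)^2+(c2-b2)^2))
    (hIca : ((0-c1)*(a2-c2)-(r-c2)*(a1-c1))^2 = r^2*((a1-c1)^2+(a2-c2)^2))
    (hB : (b1-o1)^2+(b2-o2)^2=R^2) (hC : (c1-o1)^2+(c2-o2)^2=R^2)
    (p q s : ℝ) (hp : 0 ≤ p) (hq : 0 ≤ q) (hs0 : 0 ≤ s) (hpqs : p+q+s=1)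
    (hD1 : d1 = p*a1+q*b1+s*c1) (hD2 : d2 = p*a2+q*b2+s*c2)
    (hDab : ((d1-a1)*(b2-a2)-(d2-a2)*(b1-a1))^2 = ρ^2*((b1-a1)^2+(b2-a2)^2))
    (hDac : ((d1-a1)*(c2-a2)-(d2-a2)*(c1-a1))^2 = ρ^2*((c1-a1)^2+(c2-a2)^2))
    (hext : (o1-d1)^2+(o2-d2)^2=(R+ρ)^2)
    (hTω : (t1-o1)^2+(t2-o2)^2=R^2)
    (τ : ℝ) (hτ : 0 ≤ τ) (hT1 : t1 = o1+τ*(d1-o1)) (hT2 : t2 = o2+τ*(d2-o2))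
    (z : ℝ) (hL1 : 0 = b1+z*(c1-b1)) (hL2 : 0 = b2+z*(c2-b2))
    (l : ℝ) (hl1 : l1 = a1+l*(0-a1)) (hl2 : l2 = a2+l*(0-a2))
    (u v w : ℝ) (hu : 0 ≤ u) (hv : 0 ≤ v) (hw : 0 ≤ w) (huvw : u+v+w=1)
    (hl2' : l2 = u*a2+v*b2+w*c2)
    (hlγ : (d1-l1)^2+(d2-l2)^2=ρ^2)
    (m : ℝ) (hm1 : x1 = a1+m*(0-a1)) (hm2 : x2 = a2+m*(0-a2))
    (hmγ : (d1-x1)^2+(d2-x2)^2=ρ^2)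
    (hclose : (a1-x1)^2+(a2-x2)^2 < (a1-l1)^2+(a2-l2)^2) :
    (0-t1)*(l1-t1)+(r-t2)*(l2-t2)=0 := by
  -- foot
  have hbc : b2 = c2 := by
    have e : (0-b1)*(c2-b2)-(r-b2)*(c1-b1) = -r*(c1-b1) := by
      have h1 : b1 = -(z*(c1-b1)) := by linarith
      have h2 : b2 = -(z*(c2-b2)) := by linarith
      linear_combination (c1-b1)*h2 - (c2-b2)*h1
    rw [e] at hIbc
    have : r^2*(c2-b2)^2=0 := by linarith
    have : (c2-b2)=0 := by
      rcases mul_eq_zero.1 this with h | h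
      · exact absurd h (pow_pos hr 2).ne'
      · exact pow_eq_zero_iff (two_ne_zero) |>.1 h
    linarith
  have hb2 : b2 = 0 := by rw [← hbc] at hL2; linarith
  have hc2 : c2 = 0 := by linarith
  subst hb2
  subst hc2
  have hα' : α*a2 = r := by linarith
  have hαp : 0 < α := by
    rcases hα.eq_or_lt with h | h
    · rw [← h] at hα'; linarith
    · exact h
  have hh : 0 < a2 := (mul_pos_iff_of_pos_left hαp).1 (by rw [hα']; exact hr)
  have hbc' : b1 ≠ c1 := by
    rintro rfl; apply hΔ; ring
  have vb : (a2-2*r)*b1^2+2*r*a1*b1-r^2*a2=0 := by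
    have : a2*((a2-2*r)*b1^2+2*r*a1*b1-r^2*a2)=0 := by linear_combination hIab
    exact (mul_eq_zero.1 this).resolve_left hh.ne'
  have vc : (a2-2*r)*c1^2+2*r*a1*c1-r^2*a2=0 := by
    have : a2*((a2-2*r)*c1^2+2*r*a1*c1-r^2*a2)=0 := by linear_combination hIca
    exact (mul_eq_zero.1 this).resolve_left hh.ne'
  have v1 : (a2-2*r)*(b1+c1) = -2*r*a1 := by
    have : (b1-c1)*((a2-2*r)*(b1+c1) +2*r*a1)=0 := by linear_combination vb-vc
    have := (mul_eq_zero.1 this).resolve_left (sub_ne_zero.2 hbc')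
    linarith
  have v2 : (a2-2*r)*(b1*c1) = -r^2*a2 := by
    have : (b1-c1)*((a2-2*r)*(b1*c1) +r^2*a2)=0 := by linear_combination c1*vb-b1*vc
    have := (mul_eq_zero.1 this).resolve_left (sub_ne_zero.2 hbc')
    linarith
  have hra : 0 < r^2*a2 := by positivity
  have h2r : 2*r < a2 := by
    by_contra hcon
    push Not at hcon
    have hlt : 0 < 2*r-a2 := by
      rcases hcon.eq_or_lt with h | h
      · rw [h] at v2 hra; linarith
      · linarith
    have hbcp : 0 < b1*c1 := (mul_pos_iff_of_pos_left hlt).1 (lt_of_lt_of_eq hra (by linear_combination v2))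
    have hx : (2*r-a2)*(b1+c1)=2*r*a1 := by linarith
    rcases pos_and_pos_or_neg_and_neg_of_mul_pos hbcp with ⟨h1,h2⟩ | ⟨h1,h2⟩
    · have : 0 < 2*r*a1 := by rw [← hx]; positivity
      have : 0 < a1 := (mul_pos_iff_of_pos_left (by positivity)).1 this
      have := mul_pos hαp this
      have := mul_nonneg hβ h1.le
      have := mul_nonneg hγ h2.le
      linarith
    · have : 2*r*a1 < 0 := by rw [← hx]; exact mul_neg_of_pos_of_neg hlt (by linarith)
      have : a1 < 0 := by
        by_contra h
        exact absurd this (not_lt.2 (mul_nonneg (by positivity) (not_lt.1 h)))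
      have := mul_neg_of_pos_of_neg hαp this
      have := mul_nonpos_of_nonneg_of_nonpos hβ h1.le
      have := mul_nonpos_of_nonneg_of_nonpos hγ h2.le
      linarith
  have hP : b1*c1 < 0 := by
    by_contra h
    have h9 := mul_nonneg (sub_nonneg.2 h2r.le) (not_lt.1 h)
    rw [v2] at h9
    linarith only [h9, hra]
  -- D
  have e1 : q*r = β*ρ := by
    have hΔ2 := pow_ne_zero 2 hΔ
    have f1 : ((b1-a1)*(0-a2)-(0-a2)*(c1-a1))^2*((q*r)^2-(β*ρ)^2) = 0 := by
      have g1 : (d1-a1)*(0-a2)-(d2-a2)*(c1-a1) = q*((b1-a1)*(0-a2)-(0-a2)*(c1-a1)) := by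
        obtain rfl : p = 1-q-s := by linarith
        rw [hD1,hD2]; ring
      have g2 : (0-c1)*(a2-0)-(r-0)*(a1-c1) = -β*((b1-a1)*(0-a2)-(0-a2)*(c1-a1)) := by
        obtain rfl : α = 1-β-γ := by linarith
        linear_combination a2*hI1 - (a1-c1)*hI2
      rw [g1] at hDac
      rw [g2] at hIca
      linear_combination r^2*hDac-ρ^2*hIca
    have := (mul_eq_zero.1 f1).resolve_left hΔ2
    exact (sq_eq_sq₀ (by positivity) (by positivity)).1 (by linarith)
  have e2 : s*r = γ*ρ := by
    have hΔ2 := pow_ne_zero 2 hΔ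
    have f1 : ((b1-a1)*(0-a2)-(0-a2)*(c1-a1))^2*((s*r)^2-(γ*ρ)^2) = 0 := by
      have g1 : (d1-a1)*(0-a2)-(d2-a2)*(b1-a1) = -s*((b1-a1)*(0-a2)-(0-a2)*(c1-a1)) := by
        obtain rfl : p = 1-q-s := by linarith
        rw [hD1,hD2]; ring
      have g2 : (0-a1)*(0-a2)-(r-a2)*(b1-a1) = -γ*((b1-a1)*(0-a2)-(0-a2)*(c1-a1)) := by
        obtain rfl : α = 1-β-γ := by linarith
        linear_combination (-a2)*hI1 - (b1-a1)*hI2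
      rw [g1] at hDab
      rw [g2] at hIab
      linear_combination r^2*hDab-ρ^2*hIab
    have := (mul_eq_zero.1 f1).resolve_left hΔ2
    exact (sq_eq_sq₀ (by positivity) (by positivity)).1 (by linarith)
  obtain ⟨k, rfl⟩ : ∃ k, ρ = k*r := ⟨ρ/r, by field_simp⟩
  have hk : 0 < k := (mul_pos_iff_of_pos_right hr).1 hρ
  have hq' : q = β*k := by
    apply mul_right_cancel₀ hr.ne'; linarith
  have hs' : s = γ*k := by
    apply mul_right_cancel₀ hr.ne'; linarith
  have hD1' : d1 = (1-k)*a1 := by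
    obtain rfl : p = 1-q-s := by linarith
    obtain rfl : α = 1-β-γ := by linarith
    rw [hD1,hq',hs']; linear_combination (-k)*hI1
  have hD2' : d2 = (1-k)*a2+k*r := by
    obtain rfl : p = 1-q-s := by linarith
    obtain rfl : α = 1-β-γ := by linarith
    rw [hD2,hq',hs']; linear_combination (-k)*hI2
  -- l = k
  have hA : 0 < a1^2+a2^2 := by positivity
  have ql : (l-k)*((a1^2+a2^2)*(l-k)+2*k*r*a2)=0 := by
    rw [hl1,hl2,hD1',hD2'] at hlγ
    linear_combination hlγ
  have qm : (m-k)*((a1^2+a2^2)*(m-k)+2*k*r*a2)=0 := by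
    rw [hm1,hm2,hD1',hD2'] at hmγ
    linear_combination hmγ
  have hml : m^2 < l^2 := by
    rw [hl1,hl2,hm1,hm2] at hclose
    have : (a1^2+a2^2)*m^2 < (a1^2+a2^2)*l^2 := by linarith
    exact lt_of_mul_lt_mul_left this hA.le
  have hlk : l = k := by
    rcases mul_eq_zero.1 ql with h | h
    · linarith
    · exfalso
      have hlk' : l < k := by
        by_contra hc; push Not at hc
        have : 0 < 2*k*r*a2 := by positivity
        linarith only [mul_nonneg hA.le (sub_nonneg.2 hc), this, h]
      have hl0 : 0 ≤ l := by
        have : (a1^2+a2^2)*l = k*(a1^2+a2*(a2-2*r)) := by linear_combination h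
        have h3 : 0 ≤ k*(a1^2+a2*(a2-2*r)) := by
          have : 0 ≤ a2*(a2-2*r) := mul_nonneg hh.le (by linarith)
          positivity
        by_contra hc
        have h9 := mul_neg_of_pos_of_neg hA (not_le.1 hc)
        linarith only [h9, this, h3]
      rcases mul_eq_zero.1 qm with h' | h'
      · obtain rfl : m = k := by linarith
        exact absurd hml (not_lt.2 (pow_le_pow_left₀ hl0 hlk'.le 2))
      · have : m = l := by
          apply mul_left_cancel₀ hA.ne'; linarith
        rw [this] at hml; exact lt_irrefl _ hml
  subst hlk
  have hj : 0 ≤ 1-l := by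
    have : (1-l)*a2 = u*a2 := by linarith
    have := mul_right_cancel₀ hh.ne' this
    linarith
  -- circle centre
  have ho1 : o1 = (b1+c1)/2 := by
    have : (b1-c1)*(b1+c1-2*o1)=0 := by linear_combination hB-hC
    have := (mul_eq_zero.1 this).resolve_left (sub_ne_zero.2 hbc')
    linarith
  have hτ' : τ*(R+l*r) = R := by
    have : (τ*(R+l*r))^2=R^2 := by
      rw [← hTω,hT1,hT2]
      linear_combination (-τ^2)*hext
    exact (sq_eq_sq₀ (by positivity) hR.le).1 this
  have hδ : 0 < (b1-c1)^2/4 := by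
    have := sub_ne_zero.2 hbc'
    positivity
  have hSn : b1*c1+r^2 < 0 := by
    by_contra h
    have h9 := mul_nonneg (not_lt.1 h) (sub_nonneg.2 h2r.le)
    have h8 := pow_pos hr 3
    have : (b1*c1+r^2)*(a2-2*r) = -2*r^3 := by linear_combination v2
    linarith only [h9, h8, this]
  have hRR : R^2 = (b1-c1)^2/4+o2^2 := by
    rw [← hB, ho1]; ring
  have htpos : 0 < o2+R := by
    have : o2^2<R^2 := by linarith
    have := abs_lt_of_sq_lt_sq this hR.le
    have := (abs_lt.1 this).1
    linarith
  have fin := aj_alg r o1 (b1*c1) ((b1-c1)^2/4) (b1*c1+r^2) (o2+R) (1-l) R o2 hr hδ hSn hP rfl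
    (by rw [ho1]; ring) htpos rfl hj hRR a1 a2
    (by
      rw [ho1]
      apply mul_left_cancel₀ (sub_pos.2 h2r).ne'
      linear_combination a1*v2 - r^2*v1)
    (by
      linear_combination v2)
    (by
      rw [hD1',hD2'] at hext
      linear_combination hext)
  have hW : R+l*r ≠ 0 := by positivity
  have T1 : t1*(R+l*r) = l*r*o1+R*((1-l)*a1) := by
    rw [hT1, hD1']; linear_combination ((1-l)*a1-o1)*hτ'
  have T2 : t2*(R+l*r) = l*r*o2+R*((1-l)*a2+l*r) := by
    rw [hT2, hD2']; linear_combination ((1-l)*a2+l*r-o2)*hτ'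
  have hfin : (R+l*r)^2*((0-t1)*(l1-t1)+(r-t2)*(l2-t2)) = 0 := by
    have u1 : (R+l*r)*(0-t1) = -(l*r*o1+R*((1-l)*a1)) := by linarith
    have u2 : (R+l*r)*(r-t2) = (R+l*r)*r - (l*r*o2+R*((1-l)*a2+l*r)) := by linarith
    have u3 : (R+l*r)*(l1-t1) = -(l*r)*(o1-(1-l)*a1) := by rw [hl1]; linarith
    have u4 : (R+l*r)*(l2-t2) = -(l*r)*(o2+R-(1-l)*a2) := by rw [hl2]; linarith
    have : (R+l*r)^2*((0-t1)*(l1-t1)+(r-t2)*(l2-t2)) = ((R+l*r)*(0-t1))*((R+l*r)*(l1-t1))+((R+l*r)*(r-t2))*((R+l*r)*(l2-t2)) := by ring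
    rw [this,u1,u2,u3,u4]
    linear_combination (-(l*r))*fin
  exact (mul_eq_zero.1 hfin).resolve_left (pow_ne_zero 2 hW)

theorem aj_hull (A B C P : Plane) (h : P ∈ convexHull ℝ ({A, B, C} : Set Plane)) :
    ∃ α β γ : ℝ, 0 ≤ α ∧ 0 ≤ β ∧ 0 ≤ γ ∧ α + β + γ = 1 ∧ ∀ i, P i = α * A i + β * B i + γ * C i := by
  rw [convexHull_insert (by simp), convexHull_pair, mem_convexJoin] at h
  obtain ⟨a, ha, b, hb, hP⟩ := h
  rw [Set.mem_singleton_iff] at ha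
  subst ha
  obtain ⟨s, t, hs, ht, hst, rfl⟩ := hb
  obtain ⟨u, v, hu, hv, huv, rfl⟩ := hP
  refine ⟨u, v*s, v*t, hu, by positivity, by positivity, ?_, ?_⟩
  · rw [add_assoc, ← mul_add, hst, mul_one, huv]
  · intro i; simp; ring

theorem aj_line (A B P : Plane) (h : P ∈ affineSpan ℝ ({A, B} : Set Plane)) :
    ∃ s : ℝ, ∀ i, P i = A i + s * (B i - A i) := by
  rw [mem_affineSpan_pair_iff_exists_lineMap_eq] at h
  obtain ⟨s, rfl⟩ := h
  refine ⟨s, fun i => ?_⟩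
  simp [AffineMap.lineMap_apply]; ring

theorem aj_dist (P Q : Plane) (d : ℝ) (h : dist P Q = d) :
    (P 0 - Q 0)^2 + (P 1 - Q 1)^2 = d^2 := by
  rw [← h, EuclideanSpace.dist_eq, Real.sq_sqrt (by positivity)]
  simp [Fin.sum_univ_two, Real.dist_eq, sq_abs]

theorem aj_inf (A B P : Plane) (d : ℝ)
    (h : Metric.infDist P (affineSpan ℝ ({A, B} : Set Plane) : Set Plane) = d) :
    ((P 0 - A 0)*(B 1 - A 1) - (P 1 - A 1)*(B 0 - A 0))^2
      = d^2*((B 0 - A 0)^2+(B 1 - A 1)^2) := by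
  rw [← dist_orthogonalProjection_eq_infDist] at h
  set F : Plane := (orthogonalProjection (affineSpan ℝ ({A, B} : Set Plane)) P : Plane) with hF
  have hFm : F ∈ affineSpan ℝ ({A, B} : Set Plane) := orthogonalProjection_mem P
  have hdir : (B -ᵥ A) ∈ (affineSpan ℝ ({A, B} : Set Plane)).direction :=
    AffineSubspace.vsub_mem_direction (right_mem_affineSpan_pair ℝ A B) (left_mem_affineSpan_pair ℝ A B)
  have ho := vsub_orthogonalProjection_mem_direction_orthogonal (affineSpan ℝ ({A, B} : Set Plane)) P
  have ho' := (Submodule.mem_orthogonal _ _).1 ho _ hdir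
  rw [← hF] at ho'
  simp [PiLp.inner_apply, Fin.sum_univ_two] at ho'
  obtain ⟨s, hs⟩ := aj_line A B F hFm
  have hd := aj_dist _ _ _ h
  rw [← hd]
  have h0 := hs 0
  have h1 := hs 1
  have e : (P 0 - A 0)*(B 1 - A 1) - (P 1 - A 1)*(B 0 - A 0) =
      (P 0 - F 0)*(B 1 - A 1) - (P 1 - F 1)*(B 0 - A 0) := by rw [h0, h1]; ring
  rw [e]
  have ho2 : (P 0 - F 0)*(B 0 - A 0) + (P 1 - F 1)*(B 1 - A 1) = 0 := by linarith
  linear_combination (-((P 0 - F 0)*(B 0 - A 0) + (P 1 - F 1)*(B 1 - A 1)))*ho2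

theorem aj_indep (A B C : Plane) (h : AffineIndependent ℝ ![A, B, C]) :
    (B 0 - A 0)*(C 1 - A 1) - (B 1 - A 1)*(C 0 - A 0) ≠ 0 := by
  intro h0
  rw [affineIndependent_iff_not_collinear_set] at h
  apply h
  rw [collinear_iff_of_mem (p₀ := A) (by simp)]
  by_cases hAB : (B 0 - A 0)^2+(B 1 - A 1)^2 = 0
  · have e0 : B 0 - A 0 = 0 := by nlinarith [sq_nonneg (B 0 - A 0), sq_nonneg (B 1 - A 1)]
    have e1 : B 1 - A 1 = 0 := by nlinarith [sq_nonneg (B 0 - A 0), sq_nonneg (B 1 - A 1)]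
    refine ⟨C - A, ?_⟩
    rintro p (rfl | rfl | rfl)
    · exact ⟨0, by simp⟩
    · refine ⟨0, ?_⟩
      ext i; fin_cases i <;> simp <;> linarith
    · exact ⟨1, by simp⟩
  · refine ⟨B - A, ?_⟩
    rintro p (rfl | rfl | rfl)
    · exact ⟨0, by simp⟩
    · exact ⟨1, by simp⟩
    · refine ⟨((p 0 - A 0)*(B 0 - A 0)+(p 1 - A 1)*(B 1 - A 1))/((B 0 - A 0)^2+(B 1 - A 1)^2), ?_⟩
      ext i; fin_cases i <;> simp <;> field_simp
      · linear_combination (-(B 1 - A 1))*h0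
      · linear_combination ((B 0 - A 0))*h0

theorem aj_center (A B C D L' : Plane) (ρ : ℝ) (h : dist D L' = ρ)
    (hin : Metric.sphere D ρ ⊆ convexHull ℝ ({A, B, C} : Set Plane)) :
    D ∈ convexHull ℝ ({A, B, C} : Set Plane) := by
  have h1 : L' ∈ convexHull ℝ ({A, B, C} : Set Plane) := hin (by rw [Metric.mem_sphere, dist_comm, h])
  have h2 : D + (D - L') ∈ convexHull ℝ ({A, B, C} : Set Plane) := hin (by
    rw [Metric.mem_sphere, ← h]; simp [dist_eq_norm])
  have := (convex_convexHull ℝ ({A, B, C} : Set Plane)) h1 h2 (a := 1/2) (b := 1/2) (by norm_num) (by norm_num) (by norm_num)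
  convert this using 1
  module

set_option maxHeartbeats 4000000 in
theorem IT_perp_TL'
    (A B C I Oω D T : Plane) (r Rω ρ : ℝ)
    (hABC : AffineIndependent ℝ ![A, B, C])
    (hr : 0 < r)
    (hIin : I ∈ interior (convexHull ℝ ({A, B, C} : Set Plane)))
    (hIab : Metric.infDist I (affineSpan ℝ ({A, B} : Set Plane) : Set Plane) = r)
    (hIbc : Metric.infDist I (affineSpan ℝ ({B, C} : Set Plane) : Set Plane) = r)
    (hIca : Metric.infDist I (affineSpan ℝ ({C, A} : Set Plane) : Set Plane) = r)
    (hRω : 0 < Rω) (hρ : 0 < ρ)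
    (hBω : dist B Oω = Rω) (hCω : dist C Oω = Rω)
    (hγin : Metric.sphere D ρ ⊆ convexHull ℝ ({A, B, C} : Set Plane))
    (hγAB : Metric.infDist D (affineSpan ℝ ({A, B} : Set Plane) : Set Plane) = ρ)
    (hγAC : Metric.infDist D (affineSpan ℝ ({A, C} : Set Plane) : Set Plane) = ρ)
    (hext : dist Oω D = Rω + ρ)
    (hTω : dist T Oω = Rω) (hTγ : dist T D = ρ)
    (hTseg : Wbtw ℝ Oω T D)
    (hTin : T ∈ interior (convexHull ℝ ({A, B, C} : Set Plane)))
    (L L' X : Plane)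
    (hL : L ∈ affineSpan ℝ ({B, C} : Set Plane)) (hLI : dist I L = r)
    (hL' : L' ∈ affineSpan ℝ ({A, L} : Set Plane)) (hL'γ : dist D L' = ρ)
    (hX : X ∈ affineSpan ℝ ({A, L} : Set Plane)) (hXγ : dist D X = ρ)
    (hXL' : X ≠ L') (hXcloser : dist A X < dist A L') :
    ∠ I T L' = π / 2 := by
  have hL'in : L' ∈ convexHull ℝ ({A, B, C} : Set Plane) :=
    hγin (by rw [Metric.mem_sphere, dist_comm, hL'γ])
  obtain ⟨α, β, γ, hα, hβ, hγ, hs, hI⟩ := aj_hull _ _ _ _ (interior_subset hIin)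
  obtain ⟨p, q, s, hp, hq, hs0, hpqs, hD⟩ := aj_hull _ _ _ _ (aj_center A B C D L' ρ hL'γ hγin)
  obtain ⟨u, v, w, hu, hv, hw, huvw, hl⟩ := aj_hull _ _ _ _ hL'in
  obtain ⟨z, hz⟩ := aj_line _ _ _ hL
  obtain ⟨l, hl'⟩ := aj_line _ _ _ hL'
  obtain ⟨m, hm⟩ := aj_line _ _ _ hX
  obtain ⟨τ, ⟨hτ, -⟩, hT⟩ := hTseg
  have hT' : ∀ i, T i = Oω i + τ * (D i - Oω i) := by
    intro i; rw [← hT]; simp [AffineMap.lineMap_apply]; ring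
  have hΔ := aj_indep _ _ _ hABC
  have k1 := aj_inf _ _ _ _ hIab
  have k2 := aj_inf _ _ _ _ hIbc
  have k3 := aj_inf _ _ _ _ hIca
  have k4 := aj_inf _ _ _ _ hγAB
  have k5 := aj_inf _ _ _ _ hγAC
  have g1 := aj_dist _ _ _ hBω
  have g2 := aj_dist _ _ _ hCω
  have g3 := aj_dist _ _ _ hext
  have g4 := aj_dist _ _ _ hTω
  have g5 := aj_dist _ _ _ hLI
  have g6 := aj_dist _ _ _ hL'γ
  have g7 := aj_dist _ _ _ hXγ
  have g8 : (A 0 - X 0)^2 + (A 1 - X 1)^2 < (A 0 - L' 0)^2 + (A 1 - L' 1)^2 := by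
    rw [aj_dist A X _ rfl, aj_dist A L' _ rfl]
    exact pow_lt_pow_left₀ hXcloser dist_nonneg two_ne_zero
  obtain ⟨n0, hn0⟩ : ∃ n0, I 0 - L 0 = r * n0 := ⟨(I 0 - L 0)/r, by field_simp⟩
  obtain ⟨n1, hn1⟩ : ∃ n1, I 1 - L 1 = r * n1 := ⟨(I 1 - L 1)/r, by field_simp⟩
  have hn : n0^2 + n1^2 = 1 := by
    rw [hn0, hn1] at g5
    have : r^2 * (n0^2+n1^2) = r^2 * 1 := by linarith only [g5]
    exact mul_left_cancel₀ (pow_pos hr 2).ne' this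
  suffices hgoal : (I 0 - T 0)*(L' 0 - T 0) + (I 1 - T 1)*(L' 1 - T 1) = 0 by
    rw [EuclideanGeometry.angle, ← InnerProductGeometry.inner_eq_zero_iff_angle_eq_pi_div_two]
    simp [PiLp.inner_apply, Fin.sum_univ_two]
    linarith only [hgoal]
  have nrm : ∀ x y : ℝ, (n1*x-n0*y)^2+(n0*x+n1*y)^2 = x^2+y^2 := by
    intro x y; linear_combination (x^2+y^2)*hn
  have crs : ∀ x y x' y' : ℝ, (n1*x-n0*y)*(n0*x'+n1*y')-(n0*x+n1*y)*(n1*x'-n0*y') = x*y'-y*x' := by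
    intro x y x' y'; linear_combination (x*y'-y*x')*hn
  have dt : ∀ x y x' y' : ℝ, (n1*x-n0*y)*(n1*x'-n0*y')+(n0*x+n1*y)*(n0*x'+n1*y') = x*x'+y*y' := by
    intro x y x' y'; linear_combination (x*x'+y*y')*hn
  obtain ⟨f, hf⟩ : ∃ f : Plane → ℝ, ∀ P, f P = n1*(P 0 - L 0) - n0*(P 1 - L 1) := ⟨_, fun _ => rfl⟩
  obtain ⟨g, hg⟩ : ∃ g : Plane → ℝ, ∀ P, g P = n0*(P 0 - L 0) + n1*(P 1 - L 1) := ⟨_, fun _ => rfl⟩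
  have hfd : ∀ P Q, f P - f Q = n1*(P 0 - Q 0) - n0*(P 1 - Q 1) := by
    intro P Q; rw [hf, hf]; ring
  have hgd : ∀ P Q, g P - g Q = n0*(P 0 - Q 0) + n1*(P 1 - Q 1) := by
    intro P Q; rw [hg, hg]; ring
  have hfI : f I = 0 := by rw [hf, hn0, hn1]; ring
  have hgI : g I = r := by rw [hg, hn0, hn1]; linear_combination r*hn
  have hfL : f L = 0 := by rw [hf]; ring
  have hgL : g L = 0 := by rw [hg]; ring
  have bary : ∀ P : Plane, ∀ a b c : ℝ, a+b+c=1 → (∀ i, P i = a * A i + b * B i + c * C i) →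
      f P = a * f A + b * f B + c * f C ∧ g P = a * g A + b * g B + c * g C := by
    intro P a b c habc h
    obtain rfl : a = 1-b-c := by linarith only [habc]
    simp only [hf, hg, h 0, h 1]
    constructor <;> ring
  have lin : ∀ P Q S : Plane, ∀ s : ℝ, (∀ i, P i = Q i + s * (S i - Q i)) →
      f P = f Q + s * (f S - f Q) ∧ g P = g Q + s * (g S - g Q) := by
    intro P Q S s h
    simp only [hf, hg, h 0, h 1]
    constructor <;> ring
  have dd : ∀ P Q, (f P - f Q)^2 + (g P - g Q)^2 = (P 0 - Q 0)^2 + (P 1 - Q 1)^2 := by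
    intro P Q; rw [hfd, hgd, nrm]
  have cc : ∀ P Q S U : Plane, (f P - f Q)*(g S - g U) - (g P - g Q)*(f S - f U) =
      (P 0 - Q 0)*(S 1 - U 1) - (P 1 - Q 1)*(S 0 - U 0) := by
    intro P Q S U; rw [hfd, hgd, hfd, hgd, crs]
  rw [← dt, ← hfd, ← hfd, ← hgd, ← hgd, hfI, hgI]
  refine aj_core (f A) (g A) (f B) (g B) (f C) (g C) (f D) (g D) (f Oω) (g Oω) (f T) (g T)
    (f L') (g L') (f X) (g X) r Rω ρ hr hRω hρ ?_ α β γ hα hβ hγ hs ?_ ?_ ?_ ?_ ?_ ?_ ?_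
    p q s hp hq hs0 hpqs (bary D _ _ _ hpqs hD).1 (bary D _ _ _ hpqs hD).2 ?_ ?_ ?_ ?_
    τ hτ (lin _ _ _ _ hT').1 (lin _ _ _ _ hT').2 z ?_ ?_ l ?_ ?_
    u v w hu hv hw huvw (bary L' _ _ _ huvw hl).2 ?_ m ?_ ?_ ?_ ?_
  · rw [cc]; exact hΔ
  · rw [← hfI]; exact (bary I _ _ _ hs hI).1
  · rw [← hgI]; exact (bary I _ _ _ hs hI).2
  · nth_rewrite 1 [← hfI, ← hgI]; rw [cc, dd]; exact k1
  · nth_rewrite 1 [← hfI, ← hgI]; rw [cc, dd]; exact k2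
  · nth_rewrite 1 [← hfI, ← hgI]; rw [cc, dd]; exact k3
  · rw [dd]; exact g1
  · rw [dd]; exact g2
  · rw [cc, dd]; exact k4
  · rw [cc, dd]; exact k5
  · rw [dd]; exact g3
  · rw [dd]; exact g4
  · rw [← hfL]; exact (lin _ _ _ _ hz).1
  · rw [← hgL]; exact (lin _ _ _ _ hz).2
  · rw [← hfL]; exact (lin _ _ _ _ hl').1
  · rw [← hgL]; exact (lin _ _ _ _ hl').2
  · rw [dd]; exact g6
  · rw [← hfL]; exact (lin _ _ _ _ hm).1
  · rw [← hgL]; exact (lin _ _ _ _ hm).2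
  · rw [dd]; exact g7
  · rw [dd, dd]; exact g8
end
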